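/- (Diamagnetic stability for gyromagnetic factor g < 2.) For every g with 0 ≤ g < 2 there exists a finite constant c = c(g) such that for every Z ≥ 0, every smooth vector potential A : ℝ³ → ℝ³, and every smooth compactly supported ψ : ℝ³ → ℂ² with ∫|ψ|² = 1, one has Σ_{j=1}^{3} ∫_{ℝ³} |(−i∂_j + A_j)ψ|² dx + (g/2) ∫_{ℝ³} ⟨ψ(x), (Σ_j (curl A)_j(x) σ_j) ψ(x)⟩ dx − Z ∫_{ℝ³} |ψ(x)|²/(4π|x|) dx ≥ −c Z². In particular, for g < 2 the ground state energy of a one-electron ion is bounded below by −c Z² uniformly in the magnetic field. -/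

import Mathlib

open Complex Matrix MeasureTheory Real

noncomputable section

/-- Points of physical space `ℝ³`. -/
abbrev Pt := Fin 3 → ℝ

/-- The Pauli matrices `σ₁, σ₂, σ₃`. -/
def sigma : Fin 3 → Matrix (Fin 2) (Fin 2) ℂ :=
  ![!![0, 1; 1, 0], !![0, -I; I, 0], !![1, 0; 0, -1]]

/-- Partial derivative `∂_j` of a spinor-valued function. -/
def pd (j : Fin 3) (f : Pt → Fin 2 → ℂ) : Pt → Fin 2 → ℂ :=
  fun x => fderiv ℝ f x (Pi.single j 1)

/-- Partial derivative `∂_j` of a real-valued function. -/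
def pdR (j : Fin 3) (f : Pt → ℝ) : Pt → ℝ :=
  fun x => fderiv ℝ f x (Pi.single j 1)

/-- `curl A`, componentwise: `(curl A)_j = ∂_{j+1} A_{j+2} − ∂_{j+2} A_{j+1}` (cyclically). -/
def curl (A : Pt → Fin 3 → ℝ) : Pt → Fin 3 → ℝ :=
  fun x j => pdR (j + 1) (fun y => A y (j + 2)) x - pdR (j + 2) (fun y => A y (j + 1)) x

/-- `|x| = √(x₁² + x₂² + x₃²)`. -/
def rad (x : Pt) : ℝ := Real.sqrt (∑ i : Fin 3, (x i) ^ 2)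


/-- Smooth real function vanishing outside `K`. -/
def SmK (K : Set Pt) (u : Pt → ℝ) : Prop := ContDiff ℝ (⊤ : ℕ∞) u ∧ ∀ x, x ∉ K → u x = 0

/-- Integrable with zero integral. -/
def NullInt (f : Pt → ℝ) : Prop := Integrable f ∧ ∫ x, f x = 0

lemma NullInt.add {f g : Pt → ℝ} (hf : NullInt f) (hg : NullInt g) :
    NullInt (fun x => f x + g x) :=
  ⟨hf.1.add hg.1, by rw [integral_add hf.1 hg.1, hf.2, hg.2, add_zero]⟩

lemma NullInt.sub {f g : Pt → ℝ} (hf : NullInt f) (hg : NullInt g) :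
    NullInt (fun x => f x - g x) :=
  ⟨hf.1.sub hg.1, by rw [integral_sub hf.1 hg.1, hf.2, hg.2, sub_zero]⟩

lemma NullInt.cmul {f : Pt → ℝ} (hf : NullInt f) (c : ℝ) :
    NullInt (fun x => c * f x) :=
  ⟨hf.1.const_mul c, by rw [integral_const_mul, hf.2, mul_zero]⟩

lemma NullInt.le {e f g : Pt → ℝ} (he : NullInt e) (hf : Integrable f) (hg : Integrable g)
    (h : ∀ x, f x ≤ g x + e x) : ∫ x, f x ≤ ∫ x, g x := by
  have h1 : ∫ x, f x ≤ ∫ x, (g x + e x) := integral_mono hf (hg.add he.1) h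
  rwa [integral_add hg he.1, he.2, add_zero] at h1

lemma NullInt.nonneg {e g : Pt → ℝ} (he : NullInt e) (hg : Integrable g)
    (h : ∀ x, 0 ≤ g x - e x) : 0 ≤ ∫ x, g x := by
  have h1 : 0 ≤ ∫ x, (g x - e x) := integral_nonneg h
  rwa [integral_sub hg he.1, he.2, sub_zero] at h1

lemma intK {K : Set Pt} (hK : IsCompact K) {f : Pt → ℝ} (hf : Continuous f)
    (h0 : ∀ x, x ∉ K → f x = 0) : Integrable f :=
  hf.integrable_of_hasCompactSupport (HasCompactSupport.intro hK h0)

lemma pdR_zero {K : Set Pt} (hK : IsCompact K) {u : Pt → ℝ} (h0 : ∀ x, x ∉ K → u x = 0)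
    (j : Fin 3) (x : Pt) (hx : x ∉ K) : pdR j u x = 0 := by
  have : u =ᶠ[nhds x] fun _ => 0 := by
    filter_upwards [hK.isClosed.isOpen_compl.mem_nhds hx] with y hy using h0 y hy
  simp [pdR, this.fderiv_eq]

lemma pdR_smooth {u : Pt → ℝ} (hu : ContDiff ℝ (⊤ : ℕ∞) u) (j : Fin 3) :
    ContDiff ℝ (⊤ : ℕ∞) (pdR j u) := by
  have : ContDiff ℝ (⊤ : ℕ∞) (fderiv ℝ u) := hu.fderiv_right (by simp)
  exact this.clm_apply contDiff_const

lemma SmK.pdR {K : Set Pt} (hK : IsCompact K) {u : Pt → ℝ} (hu : SmK K u) (j : Fin 3) :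
    SmK K (pdR j u) := ⟨pdR_smooth hu.1 j, fun x hx => pdR_zero hK hu.2 j x hx⟩

lemma SmK.mul_left {K : Set Pt} {f u : Pt → ℝ} (hf : ContDiff ℝ (⊤ : ℕ∞) f) (hu : SmK K u) :
    SmK K (fun x => f x * u x) := ⟨hf.mul hu.1, fun x hx => by simp [hu.2 x hx]⟩

lemma SmK.int {K : Set Pt} (hK : IsCompact K) {u : Pt → ℝ} (hu : SmK K u) : Integrable u :=
  intK hK hu.1.continuous hu.2

lemma nullDiv {K : Set Pt} (hK : IsCompact K) {u : Pt → ℝ} (hu : SmK K u) (j : Fin 3) :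
    NullInt (pdR j u) := by
  refine ⟨(hu.pdR hK j).int hK, ?_⟩
  have := integral_mul_fderiv_eq_neg_fderiv_mul_of_integrable (μ := (volume : Measure Pt))
    (f := fun _ : Pt => (1 : ℝ)) (g := u) (v := Pi.single j 1) (by simp)
    (by simp only [one_mul]; exact (hu.pdR hK j).int hK) (by simpa using hu.int hK) (by simp)
    (fun x _ => (hu.1.differentiable (by simp)) x)
  simpa [pdR] using this

lemma pdR_mul {u v : Pt → ℝ} (hu : ContDiff ℝ (⊤ : ℕ∞) u) (hv : ContDiff ℝ (⊤ : ℕ∞) v)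
    (j : Fin 3) (x : Pt) :
    pdR j (fun y => u y * v y) x = u x * pdR j v x + v x * pdR j u x := by
  have h1 := (hu.differentiable (by simp)) x
  have h2 := (hv.differentiable (by simp)) x
  have := fderiv_fun_mul h1 h2
  simp [pdR, this]

lemma pdR_comm {u : Pt → ℝ} (hu : ContDiff ℝ (⊤ : ℕ∞) u) (j k : Fin 3) (x : Pt) :
    pdR j (pdR k u) x = pdR k (pdR j u) x := by
  have hs : IsSymmSndFDerivAt ℝ u x :=
    hu.contDiffAt.isSymmSndFDerivAt (by
      simp only [minSmoothness_of_isRCLikeNormedField]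
      exact WithTop.coe_le_coe.2 (le_top : (2 : ℕ∞) ≤ ⊤))
  have hd : DifferentiableAt ℝ (fderiv ℝ u) x := by
    have : ContDiff ℝ (⊤ : ℕ∞) (fderiv ℝ u) := hu.fderiv_right (by simp)
    exact (this.differentiable (by simp)) x
  have key : ∀ a b : Fin 3, pdR a (pdR b u) x
      = fderiv ℝ (fderiv ℝ u) x (Pi.single a 1) (Pi.single b 1) := by
    intro a b
    have := fderiv_clm_apply (c := fderiv ℝ u) (u := fun _ => (Pi.single b (1 : ℝ) : Pt)) hd
      (by fun_prop)
    show fderiv ℝ (fun y => fderiv ℝ u y (Pi.single b 1)) x (Pi.single a 1) = _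
    rw [this]; simp
  rw [key, key]; exact hs _ _

lemma nullJ {K : Set Pt} (hK : IsCompact K) {u v : Pt → ℝ} (hu : SmK K u) (hv : SmK K v)
    (j k : Fin 3) :
    NullInt (fun x => pdR j u x * pdR k v x - pdR k u x * pdR j v x) := by
  have h := (nullDiv hK (SmK.mul_left hu.1 (hv.pdR hK k)) j).sub
    (nullDiv hK (SmK.mul_left hu.1 (hv.pdR hK j)) k)
  convert h using 2 with x
  rw [pdR_mul hu.1 (hv.pdR hK k).1, pdR_mul hu.1 (hv.pdR hK j).1, pdR_comm hv.1 j k]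
  ring

lemma nullL {K : Set Pt} (hK : IsCompact K) {f u v : Pt → ℝ} (hf : ContDiff ℝ (⊤ : ℕ∞) f)
    (hu : SmK K u) (hv : SmK K v) (j : Fin 3) :
    NullInt (fun x => pdR j f x * u x * v x + f x * (pdR j u x * v x + u x * pdR j v x)) := by
  have h := nullDiv hK (SmK.mul_left hf (SmK.mul_left hu.1 hv)) j
  convert h using 2 with x
  rw [pdR_mul hf (hu.1.mul hv.1), pdR_mul hu.1 hv.1]
  ring

lemma coulomb_reg {K : Set Pt} (hK : IsCompact K) (A : Fin 3 → Pt → ℝ)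
    (hA : ∀ j, ContDiff ℝ (⊤ : ℕ∞) (A j))
    (a b : Fin 2 → Pt → ℝ) (ha : ∀ s, SmK K (a s)) (hb : ∀ s, SmK K (b s))
    (δ : ℝ) (hδ : 0 < δ) (ε : ℝ) (hε : 0 < ε) :
    (∫ x, (∑ s, (a s x ^ 2 + b s x ^ 2)) / Real.sqrt (∑ i, x i ^ 2 + ε)) ≤
      δ * (∫ x, ∑ j, ∑ s, ((pdR j (b s) x + A j x * a s x) ^ 2 +
        (-pdR j (a s) x + A j x * b s x) ^ 2)) +
      (1 / (4 * δ)) * ∫ x, ∑ s, (a s x ^ 2 + b s x ^ 2) := by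
  set r : Pt → ℝ := fun x => Real.sqrt (∑ i, x i ^ 2 + ε) with hr
  have hpos : ∀ x : Pt, 0 < ∑ i, x i ^ 2 + ε := fun x => by positivity
  have hrpos : ∀ x, 0 < r x := fun x => Real.sqrt_pos.2 (hpos x)
  have hr2 : ∀ x, r x ^ 2 = ∑ i, x i ^ 2 + ε := fun x => Real.sq_sqrt (hpos x).le
  have hrs : ContDiff ℝ (⊤ : ℕ∞) r := by
    apply ContDiff.sqrt
    · fun_prop
    · intro x; exact (hpos x).ne'
  have hrd : ∀ j x, pdR j r x = x j / r x := by
    intro j x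
    have h := pdR_mul hrs hrs j x
    have h2 : (fun y => r y * r y) = fun y => (∑ i, y i ^ 2) + ε := by
      funext y; rw [← hr2]; ring
    have h3 : pdR j (fun y : Pt => (∑ i, y i ^ 2) + ε) x = 2 * x j := by
      have : HasFDerivAt (fun y : Pt => (∑ i, y i ^ 2) + ε)
          (∑ i, (2 * x i) • (ContinuousLinearMap.proj i : Pt →L[ℝ] ℝ)) x := by
        apply HasFDerivAt.add_const
        apply HasFDerivAt.fun_sum
        intro i _
        have := ((ContinuousLinearMap.proj i : Pt →L[ℝ] ℝ).hasFDerivAt (x := x)).pow 2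
        simpa using this
      rw [pdR, this.fderiv]
      simp [Pi.single_apply]
    rw [h2, h3] at h
    have := (hrpos x).ne'
    field_simp
    linarith
  have hFs : ∀ j : Fin 3, ContDiff ℝ (⊤ : ℕ∞) (fun x : Pt => x j / r x) := fun j =>
    (by fun_prop : ContDiff ℝ (⊤ : ℕ∞) (fun x : Pt => x j)).div hrs fun x => (hrpos x).ne'
  have hFd : ∀ j x, pdR j (fun x : Pt => x j / r x) x = 1 / r x - x j ^ 2 / r x ^ 3 := by
    intro j x
    have h := pdR_mul hrs (hFs j) j x
    have h2 : (fun y : Pt => r y * (y j / r y)) = fun y => y j := by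
      funext y; have := (hrpos y).ne'; field_simp
    have h3 : pdR j (fun y : Pt => y j) x = 1 := by
      have : HasFDerivAt (fun y : Pt => y j) (ContinuousLinearMap.proj j : Pt →L[ℝ] ℝ) x :=
        (ContinuousLinearMap.proj j : Pt →L[ℝ] ℝ).hasFDerivAt
      rw [pdR, this.fderiv]; simp
    rw [h2, h3, hrd] at h
    have := (hrpos x).ne'
    field_simp at h ⊢
    linarith
  have N1 : ∀ j s, NullInt _ := fun j s => (nullL hK (hFs j) (ha s) (ha s) j).add
    (nullL hK (hFs j) (hb s) (hb s) j)
  have N := ((((N1 0 0).add (N1 0 1)).add ((N1 1 0).add (N1 1 1))).add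
    ((N1 2 0).add (N1 2 1))).cmul (1/2)
  have cA := fun j => (hA j).continuous
  have ca := fun s => (ha s).1.continuous
  have cb := fun s => (hb s).1.continuous
  have cda := fun j s => (pdR_smooth (ha s).1 j).continuous
  have cdb := fun j s => (pdR_smooth (hb s).1 j).continuous
  have I1 : Integrable (fun x => ∑ j, ∑ s, ((pdR j (b s) x + A j x * a s x) ^ 2 +
        (-pdR j (a s) x + A j x * b s x) ^ 2)) := by
    apply intK hK
    · fun_prop
    · intro x hx
      simp [(ha _).2 x hx, (hb _).2 x hx, pdR_zero hK (ha _).2 _ x hx, pdR_zero hK (hb _).2 _ x hx]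
  have I2 : Integrable (fun x => ∑ s, (a s x ^ 2 + b s x ^ 2)) := by
    apply intK hK
    · fun_prop
    · intro x hx
      simp [(ha _).2 x hx, (hb _).2 x hx]
  have I3 : Integrable (fun x => (∑ s, (a s x ^ 2 + b s x ^ 2)) / r x) := by
    apply intK hK
    · apply Continuous.div _ hrs.continuous fun x => (hrpos x).ne'
      fun_prop
    · intro x hx
      simp [(ha _).2 x hx, (hb _).2 x hx]
  rw [← integral_const_mul, ← integral_const_mul, ← integral_add (I1.const_mul _) (I2.const_mul _)]
  refine N.le I3 ((I1.const_mul _).add (I2.const_mul _)) ?_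
  intro x
  -- pointwise
  have hF1 : ∀ j, x j ^ 2 / r x ^ 3 = (x j / r x) ^ 2 * (1 / r x) := by
    intro j; have := (hrpos x).ne'; field_simp
  have hsum : (x 0 / r x) ^ 2 + (x 1 / r x) ^ 2 + (x 2 / r x) ^ 2 ≤ 1 := by
    have h := hr2 x
    simp only [Fin.sum_univ_three] at h
    rw [div_pow, div_pow, div_pow, ← add_div, ← add_div, div_le_one (by have := hrpos x; positivity)]
    linarith
  simp only [hFd, hF1, Fin.sum_univ_three, Fin.sum_univ_two]
  have hinv : 0 < 1 / r x := one_div_pos.2 (hrpos x)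
  have hdiv : ∀ t : ℝ, t / r x = t * (1 / r x) := fun t => by ring
  have hrx : √(x 0 ^ 2 + x 1 ^ 2 + x 2 ^ 2 + ε) = r x := by simp [hr, Fin.sum_univ_three]
  rw [hrx, hdiv (a 0 x ^ 2 + b 0 x ^ 2 + _)]
  generalize 1 / r x = w at *
  generalize x 0 / r x = F0 at *
  generalize x 1 / r x = F1 at *
  generalize x 2 / r x = F2 at *
  have pt : ∀ F A a b da db : ℝ, 0 ≤ δ * ((db + A * a) ^ 2 + (-da + A * b) ^ 2)
      + 1 / (4 * δ) * F ^ 2 * (a ^ 2 + b ^ 2) + F * (a * da + b * db) := by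
    intro F A a b da db
    have : δ * ((db + A * a) ^ 2 + (-da + A * b) ^ 2)
      + 1 / (4 * δ) * F ^ 2 * (a ^ 2 + b ^ 2) + F * (a * da + b * db)
      = δ * ((db + A * a + F * b / (2 * δ)) ^ 2 + (-da + A * b - F * a / (2 * δ)) ^ 2) := by
      field_simp; ring
    rw [this]; positivity
  have p00 := pt F0 (A 0 x) (a 0 x) (b 0 x) (pdR 0 (a 0) x) (pdR 0 (b 0) x)
  have p01 := pt F0 (A 0 x) (a 1 x) (b 1 x) (pdR 0 (a 1) x) (pdR 0 (b 1) x)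
  have p10 := pt F1 (A 1 x) (a 0 x) (b 0 x) (pdR 1 (a 0) x) (pdR 1 (b 0) x)
  have p11 := pt F1 (A 1 x) (a 1 x) (b 1 x) (pdR 1 (a 1) x) (pdR 1 (b 1) x)
  have p20 := pt F2 (A 2 x) (a 0 x) (b 0 x) (pdR 2 (a 0) x) (pdR 2 (b 0) x)
  have p21 := pt F2 (A 2 x) (a 1 x) (b 1 x) (pdR 2 (a 1) x) (pdR 2 (b 1) x)
  have hd4 : 0 < 1 / (4 * δ) := by positivity
  have q1 : 0 ≤ (1 / (4 * δ)) * ((1 - (F0 ^ 2 + F1 ^ 2 + F2 ^ 2)) *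
      (a 0 x ^ 2 + b 0 x ^ 2 + (a 1 x ^ 2 + b 1 x ^ 2))) :=
    mul_nonneg hd4.le (mul_nonneg (by linarith) (by positivity))
  have q2 : 0 ≤ w * ((1 - (F0 ^ 2 + F1 ^ 2 + F2 ^ 2)) *
      (a 0 x ^ 2 + b 0 x ^ 2 + (a 1 x ^ 2 + b 1 x ^ 2))) :=
    mul_nonneg hinv.le (mul_nonneg (by linarith) (by positivity))
  linarith

lemma coulomb {K : Set Pt} (hK : IsCompact K) (A : Fin 3 → Pt → ℝ)
    (hA : ∀ j, ContDiff ℝ (⊤ : ℕ∞) (A j))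
    (a b : Fin 2 → Pt → ℝ) (ha : ∀ s, SmK K (a s)) (hb : ∀ s, SmK K (b s))
    (δ : ℝ) (hδ : 0 < δ) :
    (∫ x, (∑ s, (a s x ^ 2 + b s x ^ 2)) / rad x) ≤
      δ * (∫ x, ∑ j, ∑ s, ((pdR j (b s) x + A j x * a s x) ^ 2 +
        (-pdR j (a s) x + A j x * b s x) ^ 2)) +
      (1 / (4 * δ)) * ∫ x, ∑ s, (a s x ^ 2 + b s x ^ 2) := by
  have ca := fun s => (ha s).1.continuous
  have cb := fun s => (hb s).1.continuous
  by_cases hI : Integrable (fun x => (∑ s, (a s x ^ 2 + b s x ^ 2)) / rad x)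
  swap
  · rw [integral_undef hI]
    have h1 : 0 ≤ ∫ x, ∑ j, ∑ s, ((pdR j (b s) x + A j x * a s x) ^ 2 +
        (-pdR j (a s) x + A j x * b s x) ^ 2) := integral_nonneg fun x => by positivity
    have h2 : 0 ≤ ∫ x, ∑ s, (a s x ^ 2 + b s x ^ 2) := integral_nonneg fun x => by positivity
    positivity
  have hne : ∀ᵐ x : Pt, x ≠ 0 := by
    simp [ae_iff]
  have hpos : ∀ x : Pt, x ≠ 0 → 0 < ∑ i, x i ^ 2 := by
    intro x hx
    obtain ⟨i, hi⟩ := Function.ne_iff.1 hx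
    exact Finset.sum_pos' (fun i _ => sq_nonneg _) ⟨i, Finset.mem_univ _, by
      have : x i ≠ 0 := hi
      positivity⟩
  have lim : Filter.Tendsto (fun n : ℕ => ∫ x : Pt, (∑ s, (a s x ^ 2 + b s x ^ 2)) /
      Real.sqrt (∑ i, x i ^ 2 + 1 / ((n : ℝ) + 1))) Filter.atTop
      (nhds (∫ x, (∑ s, (a s x ^ 2 + b s x ^ 2)) / rad x)) := by
    apply tendsto_integral_of_dominated_convergence
      (fun x => (∑ s, (a s x ^ 2 + b s x ^ 2)) / rad x) _ hI
    · intro n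
      filter_upwards [hne] with x hx
      have := hpos x hx
      have hn : 0 < 1 / ((n : ℝ) + 1) := by positivity
      rw [Real.norm_of_nonneg (by positivity)]
      unfold rad
      gcongr
      linarith
    · filter_upwards [hne] with x hx
      have := hpos x hx
      apply Filter.Tendsto.div tendsto_const_nhds
      · unfold rad
        apply (Real.continuous_sqrt.tendsto _).comp
        simpa using (tendsto_const_nhds (x := ∑ i, x i ^ 2)).add
          (tendsto_one_div_add_atTop_nhds_zero_nat (𝕜 := ℝ))
      · unfold rad; exact (Real.sqrt_pos.2 this).ne'
    · intro n
      have hn : 0 < 1 / ((n : ℝ) + 1) := by positivity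
      apply Continuous.aestronglyMeasurable
      apply Continuous.div
      · fun_prop
      · fun_prop
      · intro x; positivity
  exact le_of_tendsto' lim fun n =>
    coulomb_reg hK A hA a b ha hb δ hδ _ (by positivity)

lemma pauli_nonneg {K : Set Pt} (hK : IsCompact K) (A : Fin 3 → Pt → ℝ)
    (hA : ∀ j, ContDiff ℝ (⊤ : ℕ∞) (A j))
    (a b : Fin 2 → Pt → ℝ) (ha : ∀ s, SmK K (a s)) (hb : ∀ s, SmK K (b s)) :
    0 ≤ (∫ x, ∑ j, ∑ s, ((pdR j (b s) x + A j x * a s x) ^ 2 +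
        (-pdR j (a s) x + A j x * b s x) ^ 2)) +
      ∫ x, ((pdR 1 (A 2) x - pdR 2 (A 1) x) * (2 * (a 0 x * a 1 x + b 0 x * b 1 x))
        + (pdR 2 (A 0) x - pdR 0 (A 2) x) * (2 * (a 0 x * b 1 x - b 0 x * a 1 x))
        + (pdR 0 (A 1) x - pdR 1 (A 0) x) *
          (a 0 x ^ 2 + b 0 x ^ 2 - a 1 x ^ 2 - b 1 x ^ 2)) := by
  have cA := fun j => (hA j).continuous
  have cdA := fun k j => (pdR_smooth (hA j) k).continuous
  have ca := fun s => (ha s).1.continuous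
  have cb := fun s => (hb s).1.continuous
  have cda := fun j s => (pdR_smooth (ha s).1 j).continuous
  have cdb := fun j s => (pdR_smooth (hb s).1 j).continuous
  have I1 : Integrable (fun x => ∑ j, ∑ s, ((pdR j (b s) x + A j x * a s x) ^ 2 +
        (-pdR j (a s) x + A j x * b s x) ^ 2)) := by
    apply intK hK
    · fun_prop
    · intro x hx
      simp [(ha _).2 x hx, (hb _).2 x hx, pdR_zero hK (ha _).2 _ x hx, pdR_zero hK (hb _).2 _ x hx]
  have I2 : Integrable (fun x =>
        (pdR 1 (A 2) x - pdR 2 (A 1) x) * (2 * (a 0 x * a 1 x + b 0 x * b 1 x))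
        + (pdR 2 (A 0) x - pdR 0 (A 2) x) * (2 * (a 0 x * b 1 x - b 0 x * a 1 x))
        + (pdR 0 (A 1) x - pdR 1 (A 0) x) *
          (a 0 x ^ 2 + b 0 x ^ 2 - a 1 x ^ 2 - b 1 x ^ 2)) := by
    apply intK hK
    · fun_prop
    · intro x hx
      simp [(ha _).2 x hx, (hb _).2 x hx]
  have Jf := ((((nullJ hK (ha 0) (hb 1) 1 2).add (nullJ hK (ha 1) (hb 0) 1 2)).sub
    ((nullJ hK (ha 0) (ha 1) 2 0).add (nullJ hK (hb 0) (hb 1) 2 0))).add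
    ((nullJ hK (ha 0) (hb 0) 0 1).sub (nullJ hK (ha 1) (hb 1) 0 1))).cmul 2
  have L1 : ∀ j k, NullInt _ := fun j k =>
    ((nullL hK (hA k) (ha 0) (ha 1) j).add (nullL hK (hA k) (hb 0) (hb 1) j)).cmul 2
  have L2 : ∀ j k, NullInt _ := fun j k =>
    ((nullL hK (hA k) (ha 0) (hb 1) j).sub (nullL hK (hA k) (hb 0) (ha 1) j)).cmul 2
  have L3 : ∀ j k, NullInt _ := fun j k =>
    ((nullL hK (hA k) (ha 0) (ha 0) j).add (nullL hK (hA k) (hb 0) (hb 0) j)).sub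
    ((nullL hK (hA k) (ha 1) (ha 1) j).add (nullL hK (hA k) (hb 1) (hb 1) j))
  have E := (Jf.add ((L1 1 2).sub (L1 2 1))).add
    (((L2 2 0).sub (L2 0 2)).add ((L3 0 1).sub (L3 1 0)))
  rw [← integral_add I1 I2]
  refine E.nonneg (I1.add I2) ?_
  intro x
  simp only [Fin.sum_univ_three, Fin.sum_univ_two]
  generalize a 0 x = a0
  generalize a 1 x = a1
  generalize b 0 x = b0
  generalize b 1 x = b1
  generalize A 0 x = A0
  generalize A 1 x = A1
  generalize A 2 x = A2
  generalize pdR 0 (a 0) x = a00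
  generalize pdR 1 (a 0) x = a01
  generalize pdR 2 (a 0) x = a02
  generalize pdR 0 (a 1) x = a10
  generalize pdR 1 (a 1) x = a11
  generalize pdR 2 (a 1) x = a12
  generalize pdR 0 (b 0) x = b00
  generalize pdR 1 (b 0) x = b01
  generalize pdR 2 (b 0) x = b02
  generalize pdR 0 (b 1) x = b10
  generalize pdR 1 (b 1) x = b11
  generalize pdR 2 (b 1) x = b12
  have h : 0 ≤
      ((b02 + A2 * a0) + (b10 + A0 * a1) + (-a11 + A1 * b1)) ^ 2 +
      ((-a02 + A2 * b0) + (-a10 + A0 * b1) - (b11 + A1 * a1)) ^ 2 +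
      ((b00 + A0 * a0) - (-a01 + A1 * b0) - (b12 + A2 * a1)) ^ 2 +
      ((-a00 + A0 * b0) + (b01 + A1 * a0) - (-a12 + A2 * b1)) ^ 2 := by positivity
  refine h.trans (le_of_eq ?_)
  ring

/-- Diamagnetic stability for gyromagnetic factor `g < 2`: for every `0 ≤ g < 2` there is a
finite constant `c = c(g)` such that for all `Z ≥ 0`, all smooth vector potentials `A` and all
smooth compactly supported normalized spinors `ψ`, the quadratic form of the Pauli Hamiltonian
`(−i∇+A)² + (g/2) σ·B − Z/(4π|x|)` is bounded below by `−c Z²`, uniformly in the magnetic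
field. -/
theorem diamagnetic_stability_g_lt_two (g : ℝ) (hg0 : 0 ≤ g) (hg2 : g < 2) :
    ∃ c : ℝ, ∀ Z : ℝ, 0 ≤ Z →
      ∀ A : Pt → Fin 3 → ℝ, ContDiff ℝ (⊤ : ℕ∞) A →
      ∀ ψ : Pt → Fin 2 → ℂ, ContDiff ℝ (⊤ : ℕ∞) ψ → HasCompactSupport ψ →
      (∫ x : Pt, ∑ s : Fin 2, Complex.normSq (ψ x s)) = 1 →
      (∑ j : Fin 3, ∫ x : Pt,
          ∑ s : Fin 2, Complex.normSq ((-I) * pd j ψ x s + ((A x j : ℝ) : ℂ) * ψ x s))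
        + (g / 2) * (∫ x : Pt,
            (∑ s : Fin 2, (starRingEnd ℂ) (ψ x s) *
              ((∑ j : Fin 3, ((curl A x j : ℝ) : ℂ) • sigma j) *ᵥ ψ x) s).re)
        - Z * (∫ x : Pt, (∑ s : Fin 2, Complex.normSq (ψ x s)) / (4 * π * rad x))
      ≥ -c * Z ^ 2 := by
  have hκ : 0 < 1 - g / 2 := by linarith
  refine ⟨1 / (64 * π ^ 2 * (1 - g / 2)), ?_⟩
  intro Z hZ A hA ψ hψ hc hn
  set a : Fin 2 → Pt → ℝ := fun s x => (ψ x s).re with ha_def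
  set b : Fin 2 → Pt → ℝ := fun s x => (ψ x s).im with hb_def
  set B : Fin 3 → Pt → ℝ := fun j x => A x j with hB_def
  have hK : IsCompact (tsupport ψ) := hc
  have hψs : ∀ s, ContDiff ℝ (⊤ : ℕ∞) (fun x => ψ x s) := fun s => contDiff_pi.1 hψ s
  have ha : ∀ s, SmK (tsupport ψ) (a s) := fun s =>
    ⟨Complex.reCLM.contDiff.comp (hψs s), fun x hx => by
      simp [ha_def, image_eq_zero_of_notMem_tsupport hx]⟩
  have hb : ∀ s, SmK (tsupport ψ) (b s) := fun s =>
    ⟨Complex.imCLM.contDiff.comp (hψs s), fun x hx => by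
      simp [hb_def, image_eq_zero_of_notMem_tsupport hx]⟩
  have hB : ∀ j, ContDiff ℝ (⊤ : ℕ∞) (B j) := fun j => contDiff_pi.1 hA j
  have hd : ∀ x, DifferentiableAt ℝ ψ x := fun x => hψ.differentiable (by simp) x
  have hpa : ∀ j s x, (pd j ψ x s).re = pdR j (a s) x := by
    intro j s x
    have h : HasFDerivAt (a s) ((Complex.reCLM.comp
      (ContinuousLinearMap.proj (R := ℝ) (φ := fun _ : Fin 2 => ℂ) s)).comp (fderiv ℝ ψ x)) x :=
      (Complex.reCLM.comp (ContinuousLinearMap.proj (R := ℝ) (φ := fun _ : Fin 2 => ℂ) s)).hasFDerivAt.comp x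
        (hd x).hasFDerivAt
    rw [pdR, h.fderiv]; rfl
  have hpb : ∀ j s x, (pd j ψ x s).im = pdR j (b s) x := by
    intro j s x
    have h : HasFDerivAt (b s) ((Complex.imCLM.comp
      (ContinuousLinearMap.proj (R := ℝ) (φ := fun _ : Fin 2 => ℂ) s)).comp (fderiv ℝ ψ x)) x :=
      (Complex.imCLM.comp (ContinuousLinearMap.proj (R := ℝ) (φ := fun _ : Fin 2 => ℂ) s)).hasFDerivAt.comp x
        (hd x).hasFDerivAt
    rw [pdR, h.fderiv]; rfl
  have e1 : ∀ x, ∑ s : Fin 2, Complex.normSq (ψ x s) = ∑ s, (a s x ^ 2 + b s x ^ 2) := by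
    intro x
    refine Finset.sum_congr rfl fun s _ => ?_
    rw [Complex.normSq_apply]; simp only [ha_def, hb_def]; ring
  have e2 : ∀ j x, ∑ s : Fin 2,
      Complex.normSq ((-I) * pd j ψ x s + ((A x j : ℝ) : ℂ) * ψ x s) =
      ∑ s, ((pdR j (b s) x + B j x * a s x) ^ 2 + (-pdR j (a s) x + B j x * b s x) ^ 2) := by
    intro j x
    refine Finset.sum_congr rfl fun s _ => ?_
    rw [Complex.normSq_apply, ← hpa, ← hpb]
    simp [ha_def, hb_def, hB_def]
    ring
  have e3 : ∀ x, (∑ s : Fin 2, (starRingEnd ℂ) (ψ x s) *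
              ((∑ j : Fin 3, ((curl A x j : ℝ) : ℂ) • sigma j) *ᵥ ψ x) s).re =
      (pdR 1 (B 2) x - pdR 2 (B 1) x) * (2 * (a 0 x * a 1 x + b 0 x * b 1 x))
        + (pdR 2 (B 0) x - pdR 0 (B 2) x) * (2 * (a 0 x * b 1 x - b 0 x * a 1 x))
        + (pdR 0 (B 1) x - pdR 1 (B 0) x) *
          (a 0 x ^ 2 + b 0 x ^ 2 - a 1 x ^ 2 - b 1 x ^ 2) := by
    intro x
    have c0 : curl A x 0 = pdR 1 (B 2) x - pdR 2 (B 1) x := rfl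
    have c1 : curl A x 1 = pdR 2 (B 0) x - pdR 0 (B 2) x := rfl
    have c2 : curl A x 2 = pdR 0 (B 1) x - pdR 1 (B 0) x := rfl
    rw [← c0, ← c1, ← c2]
    simp [Fin.sum_univ_three, Fin.sum_univ_two, sigma, Matrix.mulVec, dotProduct, ha_def, hb_def]
    ring
  have e4 : ∀ x, (∑ s : Fin 2, Complex.normSq (ψ x s)) / (4 * π * rad x) =
      (1 / (4 * π)) * ((∑ s, (a s x ^ 2 + b s x ^ 2)) / rad x) := by
    intro x; rw [e1, div_mul_div_comm, one_mul]
  simp only [e4, e3, e2]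
  simp only [e1] at hn
  rw [integral_const_mul]
  have cB := fun j => (hB j).continuous
  have ca := fun s => (ha s).1.continuous
  have cb := fun s => (hb s).1.continuous
  have cda := fun j s => (pdR_smooth (ha s).1 j).continuous
  have cdb := fun j s => (pdR_smooth (hb s).1 j).continuous
  rw [← integral_finsetSum]
  swap
  · intro j _
    apply intK hK
    · fun_prop
    · intro x hx
      simp [(ha _).2 x hx, (hb _).2 x hx, pdR_zero hK (ha _).2 _ x hx, pdR_zero hK (hb _).2 _ x hx]
  have hP := pauli_nonneg hK B hB a b ha hb
  have hC := coulomb hK B hB a b ha hb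
  rw [hn] at hC
  have hT : 0 ≤ ∫ x, ∑ j, ∑ s, ((pdR j (b s) x + B j x * a s x) ^ 2 +
        (-pdR j (a s) x + B j x * b s x) ^ 2) := integral_nonneg fun x => by positivity
  generalize (∫ x, ∑ j, ∑ s, ((pdR j (b s) x + B j x * a s x) ^ 2 +
        (-pdR j (a s) x + B j x * b s x) ^ 2)) = T at *
  generalize (∫ x, (∑ s, (a s x ^ 2 + b s x ^ 2)) / rad x) = C at *
  clear hn
  generalize integral (α := Pt) (G := ℝ) _ _ = P at *
  have hTP : (1 - g / 2) * T ≤ T + g / 2 * P := by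
    have : 0 ≤ g / 2 * (T + P) := mul_nonneg (by linarith) hP
    linarith
  rcases hZ.eq_or_lt with h0 | hZpos
  · subst h0
    have : 0 ≤ (1 - g / 2) * T := mul_nonneg hκ.le hT
    simp
    linarith
  · have hπ := Real.pi_pos
    have h := hC (4 * π * (1 - g / 2) / Z) (by positivity)
    have h2 := mul_le_mul_of_nonneg_left h (by positivity : 0 ≤ Z * (1 / (4 * π)))
    have h3 : Z * (1 / (4 * π)) * (4 * π * (1 - g / 2) / Z * T +
        1 / (4 * (4 * π * (1 - g / 2) / Z)) * 1) =
        (1 - g / 2) * T + 1 / (64 * π ^ 2 * (1 - g / 2)) * Z ^ 2 := by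
      field_simp
      ring
    rw [h3] at h2
    linarith
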